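/- (Matrix representation of parafermionic observables: commutation relations.) Let ω = e^{2πi/3} and define the 9×9 complex matrices (as Kronecker products of 3×3 matrices): A₀ = diag(1, ω, ω⁻¹) ⊗ 1, A₁ = P ⊗ 1 where P is the cyclic permutation matrix with P e₁ = e₃, P e₂ = e₁, P e₃ = e₂ (i.e. rows (0,1,0),(0,0,1),(1,0,0)), B₀ = 1 ⊗ diag(1, ω, ω⁻¹), B₁ = 1 ⊗ P, B₀' = M ⊗ P where M has rows (0, ω⁻¹, 0),(0, 0, ω),(1, 0, 0), and B₁' = M ⊗ N where N has rows (0,0,1),(ω⁻¹,0,0),(0,ω,0). Then: A₀A₁ = e^{−2πi/3}·A₁A₀; B₀B₁ = e^{−2πi/3}·B₁B₀; B₀'B₁' = e^{−2πi/3}·B₁'B₀'; A_j B_k = B_k A_j for all j,k ∈ {0,1}; and A_j B_k' = e^{4πi/3}·B_k' A_j for all j,k ∈ {0,1}. -/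

import Mathlib

open Matrix Kronecker

noncomputable def pfω : ℂ := Complex.exp (2 * Real.pi * Complex.I / 3)

noncomputable def pfD : Matrix (Fin 3) (Fin 3) ℂ := !![1, 0, 0; 0, pfω, 0; 0, 0, pfω⁻¹]

noncomputable def pfP : Matrix (Fin 3) (Fin 3) ℂ := !![0, 1, 0; 0, 0, 1; 1, 0, 0]

noncomputable def pfM : Matrix (Fin 3) (Fin 3) ℂ := !![0, pfω⁻¹, 0; 0, 0, pfω; 1, 0, 0]

noncomputable def pfN : Matrix (Fin 3) (Fin 3) ℂ := !![0, 0, 1; pfω⁻¹, 0, 0; 0, pfω, 0]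

noncomputable def pfA₀ : Matrix (Fin 3 × Fin 3) (Fin 3 × Fin 3) ℂ := pfD ⊗ₖ (1 : Matrix (Fin 3) (Fin 3) ℂ)

noncomputable def pfA₁ : Matrix (Fin 3 × Fin 3) (Fin 3 × Fin 3) ℂ := pfP ⊗ₖ (1 : Matrix (Fin 3) (Fin 3) ℂ)

noncomputable def pfB₀ : Matrix (Fin 3 × Fin 3) (Fin 3 × Fin 3) ℂ := (1 : Matrix (Fin 3) (Fin 3) ℂ) ⊗ₖ pfD

noncomputable def pfB₁ : Matrix (Fin 3 × Fin 3) (Fin 3 × Fin 3) ℂ := (1 : Matrix (Fin 3) (Fin 3) ℂ) ⊗ₖ pfP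

noncomputable def pfB₀' : Matrix (Fin 3 × Fin 3) (Fin 3 × Fin 3) ℂ := pfM ⊗ₖ pfP

noncomputable def pfB₁' : Matrix (Fin 3 × Fin 3) (Fin 3 × Fin 3) ℂ := pfM ⊗ₖ pfN

theorem pfω_ne_zero : pfω ≠ 0 := Complex.exp_ne_zero _

theorem pfω_pow_three : pfω ^ 3 = 1 := by
  rw [pfω, ← Complex.exp_nat_mul, ← Complex.exp_two_pi_mul_I]
  congr 1
  push_cast
  ring

theorem exp_neg_eq_pfω_inv : Complex.exp (-(2 * Real.pi * Complex.I) / 3) = pfω⁻¹ := by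
  rw [pfω, ← Complex.exp_neg, neg_div]

theorem pfω_mul_self : pfω * pfω = pfω⁻¹ :=
  eq_inv_of_mul_eq_one_left (by linear_combination pfω_pow_three)

theorem exp_four_eq_pfω_inv : Complex.exp (4 * Real.pi * Complex.I / 3) = pfω⁻¹ := by
  rw [← pfω_mul_self, ← sq, pfω, ← Complex.exp_nat_mul]
  congr 1
  push_cast
  ring

theorem pfω_inv_mul_inv : pfω⁻¹ * pfω⁻¹ = pfω := by
  rw [← pfω_mul_self]
  linear_combination pfω * pfω_pow_three

theorem pfD_mul_pfP : pfD * pfP = pfω⁻¹ • (pfP * pfD) := by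
  ext i j
  fin_cases i <;> fin_cases j <;>
    simp [pfD, pfP, Matrix.mul_apply, Fin.sum_univ_three, pfω_ne_zero, pfω_inv_mul_inv]

theorem pfD_mul_pfM : pfD * pfM = pfω⁻¹ • (pfM * pfD) := by
  ext i j
  fin_cases i <;> fin_cases j <;>
    simp [pfD, pfM, Matrix.mul_apply, Fin.sum_univ_three, pfω_ne_zero, pfω_mul_self]

theorem pfP_mul_pfM : pfP * pfM = pfω⁻¹ • (pfM * pfP) := by
  ext i j
  fin_cases i <;> fin_cases j <;>
    simp [pfP, pfM, Matrix.mul_apply, Fin.sum_univ_three, pfω_ne_zero, pfω_inv_mul_inv]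

theorem pfP_mul_pfN : pfP * pfN = pfω⁻¹ • (pfN * pfP) := by
  ext i j
  fin_cases i <;> fin_cases j <;>
    simp [pfP, pfN, Matrix.mul_apply, Fin.sum_univ_three, pfω_ne_zero, pfω_inv_mul_inv]

theorem parafermion_matrix_commutation_relations :
    pfA₀ * pfA₁ = Complex.exp (-(2 * Real.pi * Complex.I) / 3) • (pfA₁ * pfA₀) ∧
    pfB₀ * pfB₁ = Complex.exp (-(2 * Real.pi * Complex.I) / 3) • (pfB₁ * pfB₀) ∧
    pfB₀' * pfB₁' = Complex.exp (-(2 * Real.pi * Complex.I) / 3) • (pfB₁' * pfB₀') ∧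
    pfA₀ * pfB₀ = pfB₀ * pfA₀ ∧
    pfA₀ * pfB₁ = pfB₁ * pfA₀ ∧
    pfA₁ * pfB₀ = pfB₀ * pfA₁ ∧
    pfA₁ * pfB₁ = pfB₁ * pfA₁ ∧
    pfA₀ * pfB₀' = Complex.exp (4 * Real.pi * Complex.I / 3) • (pfB₀' * pfA₀) ∧
    pfA₀ * pfB₁' = Complex.exp (4 * Real.pi * Complex.I / 3) • (pfB₁' * pfA₀) ∧
    pfA₁ * pfB₀' = Complex.exp (4 * Real.pi * Complex.I / 3) • (pfB₀' * pfA₁) ∧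
    pfA₁ * pfB₁' = Complex.exp (4 * Real.pi * Complex.I / 3) • (pfB₁' * pfA₁) := by
  simp only [exp_neg_eq_pfω_inv, exp_four_eq_pfω_inv, pfA₀, pfA₁, pfB₀, pfB₁, pfB₀', pfB₁',
    ← Matrix.mul_kronecker_mul, Matrix.one_mul, Matrix.mul_one, pfD_mul_pfP, pfD_mul_pfM,
    pfP_mul_pfM, pfP_mul_pfN, Matrix.smul_kronecker, Matrix.kronecker_smul, and_self]
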